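/- Let (u_p)_{p>1} be a family of nodal solutions of (𝒫_p) satisfying condition (A), let NL_p := {x ∈ Ω : u_p(x) = 0}, and set ε̃_p := (p·(−u_p(x_p⁻))^{p−1})^{−1/2}. If dist(x_p⁻, NL_p)/ε̃_p → +∞ as p → +∞, then dist(x_p⁻, ∂Ω)/ε̃_p → +∞ as p → +∞. -/

import Mathlib

open MeasureTheory Real Set Filter Topology Metric

noncomputable section

/-- The Euclidean plane. -/
abbrev R2 : Type := EuclideanSpace ℝ (Fin 2)

/-- The Laplacian: sum of the two pure second directional derivatives. -/
def lap (u : R2 → ℝ) (x : R2) : ℝ :=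
  ∑ i : Fin 2,
    fderiv ℝ (fun y => fderiv ℝ u y (EuclideanSpace.single i 1)) x (EuclideanSpace.single i 1)

/-- Each point of ∂Ω has a neighborhood in which ∂Ω is the graph of a C^∞ function
(in suitable Euclidean coordinates). -/
def SmoothBoundary (Ω : Set R2) : Prop :=
  ∀ x ∈ frontier Ω, ∃ V : Set R2, IsOpen V ∧ x ∈ V ∧
    ∃ (e : R2 ≃ᵢ R2) (g : ℝ → ℝ), ContDiff ℝ (⊤ : ℕ∞) g ∧
      frontier Ω ∩ V = {y | y ∈ V ∧ e y 1 = g (e y 0)}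

/-- A (classical) solution of the Lane–Emden problem `(𝒫_p)` on Ω. -/
def IsSolution (Ω : Set R2) (p : ℝ) (u : R2 → ℝ) : Prop :=
  ContDiffOn ℝ 2 u Ω ∧ ContDiffOn ℝ 1 u (closure Ω) ∧
  (∀ x ∈ Ω, -lap u x = |u x| ^ (p - 1) * u x) ∧
  (∀ x ∈ frontier Ω, u x = 0)

/-- A nodal (sign-changing) function on Ω. -/
def IsNodal (Ω : Set R2) (u : R2 → ℝ) : Prop :=
  (∃ x ∈ Ω, 0 < u x) ∧ ∃ x ∈ Ω, u x < 0

/-- The energy functional E_p. -/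
def energy (Ω : Set R2) (p : ℝ) (u : R2 → ℝ) : ℝ :=
  (1 / 2) * ∫ x in Ω, ‖gradient u x‖ ^ 2 - (1 / (p + 1)) * ∫ x in Ω, |u x| ^ (p + 1)

/-- Condition (A): p·∫_Ω |∇u_p|² → 16πe. -/
def CondA (Ω : Set R2) (u : ℝ → R2 → ℝ) : Prop :=
  Tendsto (fun p : ℝ => p * ∫ x in Ω, ‖gradient (u p) x‖ ^ 2) atTop
    (𝓝 (16 * π * Real.exp 1))

/-- Condition (B): p·(u_p(x_p⁺) + u_p(x_p⁻)) → K for some K ≥ 0. -/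
def CondB (u : ℝ → R2 → ℝ) (xp xm : ℝ → R2) : Prop :=
  ∃ K : ℝ, 0 ≤ K ∧ Tendsto (fun p : ℝ => p * (u p (xp p) + u p (xm p))) atTop (𝓝 K)

/-- ε_p := (p·u_p(x_p⁺)^{p−1})^{−1/2}. -/
def eps (u : ℝ → R2 → ℝ) (xp : ℝ → R2) (p : ℝ) : ℝ :=
  1 / Real.sqrt (p * u p (xp p) ^ (p - 1))

/-- The rescaling z_p of u_p around x_p⁺. -/
def zp (u : ℝ → R2 → ℝ) (xp : ℝ → R2) (p : ℝ) (x : R2) : ℝ :=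
  (p / u p (xp p)) * (u p (eps u xp p • x + xp p) - u p (xp p))

/-- The rescaling z_p⁻ of u_p around x_p⁻ (with the scale ε_p of the maximum). -/
def zm (u : ℝ → R2 → ℝ) (xp xm : ℝ → R2) (p : ℝ) (x : R2) : ℝ :=
  (p / u p (xp p)) * (-u p (eps u xp p • x + xm p) - u p (xp p))

/-- Convergence in C²_loc(ℝ²) of a family of functions f_i defined on sets D_i:
every compact set K is eventually contained in D_i, and on K all derivatives up to
order 2 converge uniformly. -/
def TendstoC2loc {ι : Type} (l : Filter ι) (D : ι → Set R2) (f : ι → R2 → ℝ)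
    (g : R2 → ℝ) : Prop :=
  ∀ K : Set R2, IsCompact K →
    (∀ᶠ i in l, K ⊆ D i) ∧
    ∀ n : ℕ, n ≤ 2 →
      TendstoUniformlyOn (fun i x => iteratedFDeriv ℝ n (f i) x)
        (fun x => iteratedFDeriv ℝ n g x) l K

/-- The standard bubble U(x) = −2 log(1 + |x|²/8). -/
def stdBubble (x : R2) : ℝ := -2 * Real.log (1 + ‖x‖ ^ 2 / 8)

/-- The bubble U_μ(x) = log(μ/(1 + μ|x|²/8)²). -/
def bubble (μ : ℝ) (x : R2) : ℝ := Real.log (μ / (1 + μ * ‖x‖ ^ 2 / 8) ^ 2)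

/-- A C^∞ function compactly supported in S. -/
def CcSmoothIn (S : Set R2) (v : R2 → ℝ) : Prop :=
  ContDiff ℝ (⊤ : ℕ∞) v ∧ HasCompactSupport v ∧ tsupport v ⊆ S

/-- The quadratic form of the linearized operator at u. -/
def Qform (p : ℝ) (u v : R2 → ℝ) : ℝ :=
  ∫ x, (‖gradient v x‖ ^ 2 - p * |u x| ^ (p - 1) * v x ^ 2)

/-- Morse index one hypothesis (M): for p large, the quadratic form of the linearized
operator is negative somewhere on C_c^∞ of the positive nodal domain, but is not
negative definite on any 2-dimensional subspace. -/
def MorseOne (Ω : Set R2) (u : ℝ → R2 → ℝ) : Prop :=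
  ∀ᶠ p : ℝ in atTop,
    (∃ v : R2 → ℝ, CcSmoothIn {x ∈ Ω | 0 < u p x} v ∧ Qform p (u p) v < 0) ∧
    ¬ ∃ v w : R2 → ℝ, CcSmoothIn {x ∈ Ω | 0 < u p x} v ∧
        CcSmoothIn {x ∈ Ω | 0 < u p x} w ∧
        LinearIndependent ℝ ![v, w] ∧
        ∀ a b : ℝ, ¬(a = 0 ∧ b = 0) →
          Qform p (u p) (fun x => a * v x + b * w x) < 0

lemma deriv_deriv_nonpos_of_isLocalMax {f : ℝ → ℝ} {t : ℝ} (hf : ContinuousAt f t)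
    (hm : IsLocalMax f t) : deriv (deriv f) t ≤ 0 := by
  by_contra! h
  have hmin := isLocalMin_of_deriv_deriv_pos h hm.deriv_eq_zero hf
  have hconst : f =ᶠ[𝓝 t] fun _ => f t := by
    filter_upwards [hm, hmin] with s hs hs' using le_antisymm hs hs'
  have h0 : deriv (deriv f) t = 0 := by
    rw [hconst.deriv.deriv_eq]
    simp
  exact h.ne' h0

/-- The second directional derivatives in `lap` are one-dimensional second derivatives. -/
lemma fderiv_fderiv_apply_eq_deriv_deriv {F : R2 → ℝ} {x : R2} (hF : ContDiffAt ℝ 2 F x) (v : R2) :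
    fderiv ℝ (fun y => fderiv ℝ F y v) x v = deriv (deriv fun t : ℝ => F (x + t • v)) 0 := by
  have hline : ∀ t : ℝ, HasDerivAt (fun t : ℝ => x + t • v) v t := fun t => by
    simpa using ((hasDerivAt_id t).smul_const v).const_add x
  have htend : Tendsto (fun t : ℝ => x + t • v) (𝓝 0) (𝓝 x) := by
    simpa using (hline 0).continuousAt.tendsto
  have hev : ∀ᶠ y in 𝓝 x, DifferentiableAt ℝ F y :=
    (hF.eventually (by simp)).mono fun y hy => hy.differentiableAt (by norm_num)
  have hd : deriv (fun t : ℝ => F (x + t • v)) =ᶠ[𝓝 0] fun t => fderiv ℝ F (x + t • v) v := by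
    filter_upwards [htend.eventually hev] with t ht
    exact (ht.hasFDerivAt.comp_hasDerivAt t (hline t)).deriv
  have hdiff : DifferentiableAt ℝ (fun y => fderiv ℝ F y v) x :=
    ((hF.fderiv_right (m := 1) (by norm_num)).differentiableAt (by norm_num)).clm_apply
      (differentiableAt_const v)
  rw [hd.deriv_eq]
  have hdiff' : HasFDerivAt (fun y => fderiv ℝ F y v) (fderiv ℝ (fun y => fderiv ℝ F y v) x)
      (x + (0 : ℝ) • v) := by simpa using hdiff.hasFDerivAt
  exact (hdiff'.comp_hasDerivAt (0 : ℝ) (hline 0)).deriv.symm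

lemma lap_nonpos_of_isLocalMax {F : R2 → ℝ} {x : R2} (hF : ContDiffAt ℝ 2 F x)
    (hm : IsLocalMax F x) : lap F x ≤ 0 := by
  refine Finset.sum_nonpos fun i _ => ?_
  rw [fderiv_fderiv_apply_eq_deriv_deriv hF]
  set v : R2 := EuclideanSpace.single i 1
  have hcont : ContinuousAt (fun t : ℝ => x + t • v) 0 := by fun_prop
  have htend : Tendsto (fun t : ℝ => x + t • v) (𝓝 0) (𝓝 x) := by simpa using hcont.tendsto
  refine deriv_deriv_nonpos_of_isLocalMax ?_ ?_
  · refine ContinuousAt.comp (g := F) ?_ hcont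
    simpa using hF.continuousAt
  · filter_upwards [htend.eventually hm] with t ht
    simpa using ht

lemma lap_const_mul_sub {f g : R2 → ℝ} {x : R2} (c : ℝ) (hf : ContDiffAt ℝ 2 f x)
    (hg : ContDiffAt ℝ 2 g x) : lap (fun y => c * f y - g y) x = c * lap f x - lap g x := by
  have key : ∀ {h : R2 → ℝ}, ContDiffAt ℝ 2 h x → (∀ᶠ y in 𝓝 x, DifferentiableAt ℝ h y) ∧
      ∀ v : R2, DifferentiableAt ℝ (fun y => fderiv ℝ h y v) x := fun {h} hh =>
    ⟨(hh.eventually (by simp)).mono fun y hy => hy.differentiableAt (by norm_num), fun v =>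
      ((hh.fderiv_right (m := 1) (by norm_num)).differentiableAt (by norm_num)).clm_apply
        (differentiableAt_const v)⟩
  obtain ⟨hf1, hf2⟩ := key hf
  obtain ⟨hg1, hg2⟩ := key hg
  unfold lap
  rw [Finset.mul_sum, ← Finset.sum_sub_distrib]
  refine Finset.sum_congr rfl fun i _ => ?_
  set v : R2 := EuclideanSpace.single i 1
  have hev : (fun y => fderiv ℝ (fun y => c * f y - g y) y v) =ᶠ[𝓝 x]
      fun y => c * fderiv ℝ f y v - fderiv ℝ g y v := by
    filter_upwards [hf1, hg1] with y hfy hgy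
    rw [fderiv_fun_sub (hfy.const_mul c) hgy, fderiv_const_mul hfy]
    simp
  rw [hev.fderiv_eq, fderiv_fun_sub ((hf2 v).const_mul c) (hg2 v), fderiv_const_mul (hf2 v)]
  simp

lemma contDiffAt_inv_norm_sub_sq {x z : R2} (h : x ≠ z) :
    ContDiffAt ℝ 2 (fun y => (‖y - z‖ ^ 2)⁻¹) x := by
  have : ‖x - z‖ ^ 2 ≠ 0 := by simpa [sub_eq_zero] using h
  exact ((contDiffAt_id.sub contDiffAt_const).norm_sq ℝ).inv this

lemma deriv_deriv_inv_quadratic {N c : ℝ} (hN : N ≠ 0) :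
    deriv (deriv fun t : ℝ => (N + 2 * c * t + t ^ 2)⁻¹) 0 = 8 * c ^ 2 / N ^ 3 - 2 / N ^ 2 := by
  have hq : ∀ t : ℝ, HasDerivAt (fun t : ℝ => N + 2 * c * t + t ^ 2) (2 * c + 2 * t) t :=
    fun t => by
      simpa using (((hasDerivAt_id t).const_mul (2 * c)).const_add N).fun_add (hasDerivAt_pow 2 t)
  have hne : ∀ᶠ t : ℝ in 𝓝 0, N + 2 * c * t + t ^ 2 ≠ 0 :=
    (hq 0).continuousAt.eventually_ne (by simpa using hN)
  have hd : deriv (fun t : ℝ => (N + 2 * c * t + t ^ 2)⁻¹) =ᶠ[𝓝 0]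
      fun t => -(2 * c + 2 * t) / (N + 2 * c * t + t ^ 2) ^ 2 := by
    filter_upwards [hne] with t ht using ((hq t).fun_inv ht).deriv
  have hnum : HasDerivAt (fun t : ℝ => -(2 * c + 2 * t)) (-2) 0 := by
    simpa using (((hasDerivAt_id (0 : ℝ)).const_mul 2).const_add (2 * c)).fun_neg
  rw [hd.deriv_eq, (hnum.fun_div ((hq 0).fun_pow 2) (by simpa using hN)).deriv]
  simp
  field_simp
  ring

lemma lap_inv_norm_sub_sq {x z : R2} (h : x ≠ z) :
    lap (fun y => (‖y - z‖ ^ 2)⁻¹) x = 4 / (‖x - z‖ ^ 2) ^ 2 := by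
  have hN : ‖x - z‖ ^ 2 ≠ 0 := by simpa [sub_eq_zero] using h
  have hi : ∀ i : Fin 2,
      fderiv ℝ (fun y => fderiv ℝ (fun y : R2 => (‖y - z‖ ^ 2)⁻¹) y (EuclideanSpace.single i 1)) x
        (EuclideanSpace.single i 1) =
      8 * (x i - z i) ^ 2 / (‖x - z‖ ^ 2) ^ 3 - 2 / (‖x - z‖ ^ 2) ^ 2 := fun i => by
    rw [fderiv_fderiv_apply_eq_deriv_deriv (contDiffAt_inv_norm_sub_sq h),
      ← deriv_deriv_inv_quadratic hN]
    congr 2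
    ext t
    congr 1
    rw [add_sub_right_comm, norm_add_sq_real, inner_smul_right, norm_smul]
    simp [EuclideanSpace.inner_single_right]
    ring
  have hsum : ‖x - z‖ ^ 2 = (x 0 - z 0) ^ 2 + (x 1 - z 1) ^ 2 := by
    simp [EuclideanSpace.norm_sq_eq, Fin.sum_univ_two]
  unfold lap
  rw [Fin.sum_univ_two, hi, hi]
  generalize ‖x - z‖ ^ 2 = N at hN hsum
  field_simp
  linear_combination -8 * hsum

/-- Near a boundary point, the side `S` of the boundary curve containing a given point of `Ω` is
relatively closed in `Ω`, and the other side contains a ball of any small radius `a` at distance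
comparable to `a` from a given boundary point. -/
lemma SmoothBoundary.exists_side {Ω : Set R2} (hop : IsOpen Ω) (hsm : SmoothBoundary Ω) {y₀ : R2}
    (hy₀ : y₀ ∈ frontier Ω) :
    ∃ r > 0, ∃ M ≥ (0 : ℝ), ∀ y ∈ frontier Ω, ∀ x ∈ Ω, y ∈ ball y₀ r → x ∈ ball y₀ r →
      ∀ a > 0, ∃ z, dist y z ≤ (1 + M) * a ∧ ∃ S : Set R2, IsOpen S ∧ x ∈ S ∧
        (∀ w ∈ S, w ∈ ball y₀ r → a ≤ dist w z) ∧
        ∀ w ∈ closure S, w ∈ Ω → w ∈ ball y₀ r → w ∈ S := by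
  obtain ⟨V, hV, hyV, e, g, hg, hgraph⟩ := hsm y₀ hy₀
  have hmem : ∀ w ∈ V, (w ∈ frontier Ω ↔ e w 1 = g (e w 0)) := fun w hw =>
    ⟨fun h => (hgraph.subset ⟨h, hw⟩).2, fun h => (hgraph.superset ⟨hw, h⟩).1⟩
  have hcoord : ∀ (v w : R2) (i : Fin 2), |e v i - e w i| ≤ dist v w := fun v w i => by
    rw [← e.dist_eq, dist_eq_norm]
    simpa using PiLp.norm_apply_le (e v - e w) i
  obtain ⟨M, T, hT, hLip⟩ := ((hg.of_le (m := 1) (by simp)).contDiffAt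
    (x := e y₀ 0)).exists_lipschitzOnWith
  obtain ⟨r₁, hr₁, hr₁T⟩ := Metric.mem_nhds_iff.1 hT
  obtain ⟨r₂, hr₂, hr₂V⟩ := Metric.isOpen_iff.1 hV y₀ hyV
  refine ⟨min r₁ r₂, lt_min hr₁ hr₂, M, M.2, fun y hy x hx hyr hxr a ha => ?_⟩
  have hVr : ∀ w ∈ ball y₀ (min r₁ r₂), w ∈ V := fun w hw =>
    hr₂V (ball_subset_ball (min_le_right _ _) hw)
  have hTr : ∀ w ∈ ball y₀ (min r₁ r₂), e w 0 ∈ T := fun w hw => by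
    refine hr₁T ?_
    rw [Metric.mem_ball, Real.dist_eq]
    exact (hcoord w y₀ 0).trans_lt ((Metric.mem_ball.1 hw).trans_le (min_le_left _ _))
  have hΩ : ∀ w ∈ Ω, w ∉ frontier Ω := fun w hw hw' => (hop.frontier_eq ▸ hw').2 hw
  have hyg := (hmem y (hVr y hyr)).1 hy
  have hxg : e x 1 - g (e x 0) ≠ 0 := fun h =>
    hΩ x hx ((hmem x (hVr x hxr)).2 (sub_eq_zero.1 h))
  obtain ⟨σ, hσ, hσx⟩ : ∃ σ : ℝ, |σ| = 1 ∧ 0 < σ * (e x 1 - g (e x 0)) := by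
    rcases hxg.lt_or_gt with h | h
    · exact ⟨-1, by simp, by linarith⟩
    · exact ⟨1, by simp, by linarith⟩
  have hσ2 : σ * σ = 1 := by rw [← abs_mul_abs_self, hσ, one_mul]
  have hcont : Continuous fun w => σ * (e w 1 - g (e w 0)) := by
    have := e.continuous
    have := hg.continuous
    fun_prop
  set z := e.symm (e y - EuclideanSpace.single 1 (σ * ((1 + M) * a))) with hz
  have hez : e z = e y - EuclideanSpace.single 1 (σ * ((1 + M) * a)) := by simp [hz]
  have hM : (0 : ℝ) ≤ M := M.2
  refine ⟨z, ?_, {w | 0 < σ * (e w 1 - g (e w 0))}, isOpen_lt continuous_const hcont, hσx, ?_, ?_⟩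
  · rw [← e.dist_eq, hez, dist_eq_norm, sub_sub_cancel, PiLp.norm_single, norm_mul,
      Real.norm_eq_abs, hσ, one_mul, Real.norm_of_nonneg (by positivity)]
  · intro w hw hwr
    by_contra! hlt
    have h0 := hcoord w z 0
    have h1 := hcoord w z 1
    have hL := hLip.dist_le_mul _ (hTr y hyr) _ (hTr w hwr)
    rw [Real.dist_eq, Real.dist_eq, abs_sub_comm (e y 0)] at hL
    simp only [hez, PiLp.sub_apply, PiLp.single_apply] at h0 h1
    norm_num at h0 h1
    have hL' : |g (e y 0) - g (e w 0)| ≤ M * a :=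
      hL.trans (mul_le_mul_of_nonneg_left (h0.trans hlt.le) hM)
    have hb1 : σ * (e w 1 - (e y 1 - σ * ((1 + M) * a))) < a := by
      refine (le_abs_self _).trans_lt ?_
      rw [abs_mul, hσ, one_mul]
      exact h1.trans_lt hlt
    have hb2 : σ * (g (e y 0) - g (e w 0)) ≤ M * a := by
      refine (le_abs_self _).trans ?_
      rwa [abs_mul, hσ, one_mul]
    have hw' : 0 < σ * (e w 1 - g (e w 0)) := hw
    rw [hyg] at hb1
    have hσa : σ * (σ * ((1 + M) * a)) = (1 + M) * a := by rw [← mul_assoc, hσ2, one_mul]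
    linarith
  · intro w hw hwΩ hwr
    have hle : 0 ≤ σ * (e w 1 - g (e w 0)) := closure_lt_subset_le continuous_const hcont hw
    refine lt_of_le_of_ne hle fun h => hΩ w hwΩ ((hmem w (hVr w hwr)).2 ?_)
    rcases mul_eq_zero.1 h.symm with h | h
    · simp [h] at hσ
    · exact sub_eq_zero.1 h

/-- Comparison with the strictly subharmonic barrier `m a² / |x - z|²`: a function bounded below
by `-m` in `Ω` and vanishing on `∂Ω` cannot attain `-m` too close to a hole of radius `a`. -/
lemma ne_neg_of_barrier {Ω S : Set R2} {u : R2 → ℝ} {x z : R2} {m a L : ℝ} (hop : IsOpen Ω)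
    (hS : IsOpen S) (hu2 : ContDiffOn ℝ 2 u Ω) (huc : ContinuousOn u (closure Ω))
    (hu0 : ∀ y ∈ frontier Ω, u y = 0) (hm : 0 < m) (ha : 0 < a) (hum : ∀ y ∈ Ω, -m ≤ u y)
    (hlap : ∀ y ∈ Ω, lap u y < 4 * (m * a ^ 2) / L ^ 4) (hx : x ∈ Ω) (hxS : x ∈ S)
    (hxL : dist x z < L) (hSa : ∀ w ∈ S, w ∈ closedBall z L → a ≤ dist w z)
    (hScl : ∀ w ∈ closure S, w ∈ Ω → w ∈ closedBall z L → w ∈ S) : u x ≠ -m := by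
  intro hux
  set D := Ω ∩ S ∩ ball z L with hD
  have hDo : IsOpen D := (hop.inter hS).inter isOpen_ball
  have hclΩ : closure D ⊆ closure Ω := closure_mono fun w hw => hw.1.1
  have hclS : closure D ⊆ closure S := closure_mono fun w hw => hw.1.2
  have hclL : closure D ⊆ closedBall z L :=
    closure_minimal (fun w hw => ball_subset_closedBall hw.2) isClosed_closedBall
  have hcla : ∀ w ∈ closure D, a ≤ dist w z := fun w hw =>
    closure_minimal (t := {w | a ≤ dist w z})
      (fun v hv => hSa v hv.1.2 (ball_subset_closedBall hv.2))
      (isClosed_le continuous_const (by fun_prop)) hw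
  have hne : ∀ w ∈ closure D, w ≠ z := fun w hw h => by
    have := hcla w hw
    rw [h, dist_self] at this
    exact this.not_gt ha
  have hcompact : IsCompact (closure D) :=
    (isCompact_closedBall z L).of_isClosed_subset isClosed_closure hclL
  have hxD : x ∈ D := ⟨⟨hx, hxS⟩, hxL⟩
  have hL : 0 < L := dist_nonneg.trans_lt hxL
  set F : R2 → ℝ := fun y => m * a ^ 2 * (‖y - z‖ ^ 2)⁻¹ - u y with hF
  have hFc : ContinuousOn F (closure D) := by
    refine ContinuousOn.sub (continuousOn_const.mul fun w hw => ?_) (huc.mono hclΩ)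
    exact (contDiffAt_inv_norm_sub_sq (hne w hw)).continuousAt.continuousWithinAt
  obtain ⟨w, hw, hmax⟩ := hcompact.exists_isMaxOn ⟨x, subset_closure hxD⟩ hFc
  have hFw : m * a ^ 2 * (L ^ 2)⁻¹ + m < F w := by
    refine lt_of_lt_of_le ?_ (hmax (subset_closure hxD))
    have hpos : 0 < ‖x - z‖ := norm_pos_iff.2 (sub_ne_zero.2 (hne x (subset_closure hxD)))
    rw [dist_eq_norm] at hxL
    simp only [hF, hux, sub_neg_eq_add]
    gcongr
  have hdw : 0 < ‖w - z‖ := norm_pos_iff.2 (sub_ne_zero.2 (hne w hw))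
  have haw : a ≤ ‖w - z‖ := dist_eq_norm w z ▸ hcla w hw
  have hwΩ : w ∈ Ω := by
    by_contra hwn
    have h0 : u w = 0 := hu0 w (hop.frontier_eq ▸ ⟨hclΩ hw, hwn⟩)
    have h1 : m * a ^ 2 * (‖w - z‖ ^ 2)⁻¹ ≤ m := by
      rw [← div_eq_mul_inv, div_le_iff₀ (by positivity)]
      gcongr
    have h2 : 0 < m * a ^ 2 * (L ^ 2)⁻¹ := by positivity
    simp only [hF, h0] at hFw
    linarith
  have hwL : dist w z < L := by
    refine lt_of_le_of_ne (hclL hw) fun h => ?_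
    have := hum w hwΩ
    rw [dist_eq_norm] at h
    simp only [hF, h] at hFw
    linarith
  have hwD : w ∈ D := ⟨⟨hwΩ, hScl w (hclS hw) hwΩ (hclL hw)⟩, hwL⟩
  have hloc : IsLocalMax F w :=
    (hmax.on_subset subset_closure).isLocalMax (hDo.mem_nhds hwD)
  have huw : ContDiffAt ℝ 2 u w := hu2.contDiffAt (hop.mem_nhds hwΩ)
  have hb := contDiffAt_inv_norm_sub_sq (hne w hw)
  have hle := lap_nonpos_of_isLocalMax ((contDiffAt_const.mul hb).sub huw) hloc
  rw [lap_const_mul_sub _ hb huw, lap_inv_norm_sub_sq (hne w hw)] at hle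
  have hlt := hlap w hwΩ
  have hcmp : 4 * (m * a ^ 2) / L ^ 4 ≤ m * a ^ 2 * (4 / (‖w - z‖ ^ 2) ^ 2) := by
    rw [dist_eq_norm] at hwL
    rw [← pow_mul, mul_comm 4, mul_div_assoc]
    gcongr
  linarith

lemma neg_abs_rpow_mul_le {p m t : ℝ} (hp : 1 < p) (hm : 0 < m) (ht : -m ≤ t) :
    -(|t| ^ (p - 1) * t) ≤ m ^ (p - 1) * m := by
  rcases le_or_gt 0 t with h | h
  · have : 0 ≤ |t| ^ (p - 1) * t := by positivity
    have : 0 ≤ m ^ (p - 1) * m := by positivity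
    linarith
  · have hab : |t| ≤ m := by rw [abs_of_neg h]; linarith
    rw [← mul_neg]
    have : |t| ^ (p - 1) ≤ m ^ (p - 1) := Real.rpow_le_rpow (abs_nonneg t) hab (by linarith)
    exact mul_le_mul this (by linarith) (by linarith) (by positivity)

lemma frontier_nonempty_of_isBounded {Ω : Set R2} (hne : Ω.Nonempty)
    (hbdd : Bornology.IsBounded Ω) : (frontier Ω).Nonempty := by
  by_contra! h
  rcases isClopen_iff.1 (isClopen_iff_frontier_eq_empty.2 h) with h | h
  · exact hne.ne_empty h
  · exact NormedSpace.unbounded_univ ℝ R2 (h ▸ hbdd)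

theorem stmt14
    (Ω : Set R2) (hne : Ω.Nonempty) (hop : IsOpen Ω)
    (hbdd : Bornology.IsBounded Ω) (hconn : IsConnected Ω) (hsm : SmoothBoundary Ω)
    (u : ℝ → R2 → ℝ)
    (hsol : ∀ p > (1:ℝ), IsSolution Ω p (u p))
    (hnod : ∀ p > (1:ℝ), IsNodal Ω (u p))
    (xp xm : ℝ → R2)
    (hxpmem : ∀ p > (1:ℝ), xp p ∈ Ω)
    (hxpmax : ∀ p > (1:ℝ), ∀ x ∈ Ω, u p x ≤ u p (xp p))
    (hxmmem : ∀ p > (1:ℝ), xm p ∈ Ω)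
    (hxmmin : ∀ p > (1:ℝ), ∀ x ∈ Ω, u p (xm p) ≤ u p x)
    (hcomp : ∀ p > (1:ℝ), -u p (xm p) ≤ u p (xp p))
    (hA : CondA Ω u)
    (hNL : Tendsto
      (fun p : ℝ => Metric.infDist (xm p) {x ∈ Ω | u p x = 0} /
        (1 / Real.sqrt (p * (-u p (xm p)) ^ (p - 1)))) atTop atTop) :
    Tendsto
      (fun p : ℝ => Metric.infDist (xm p) (frontier Ω) /
        (1 / Real.sqrt (p * (-u p (xm p)) ^ (p - 1)))) atTop atTop := by
  set ε : ℝ → ℝ := fun p => 1 / Real.sqrt (p * (-u p (xm p)) ^ (p - 1)) with hε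
  have hm : ∀ p > (1 : ℝ), 0 < -u p (xm p) := fun p hp => by
    obtain ⟨x, hx, hux⟩ := (hnod p hp).2
    linarith [hxmmin p hp x hx]
  have hQ : ∀ p > (1 : ℝ), 0 < p * (-u p (xm p)) ^ (p - 1) := fun p hp =>
    mul_pos (by linarith) (Real.rpow_pos_of_pos (hm p hp) _)
  have hεpos : ∀ p > (1 : ℝ), 0 < ε p := fun p hp =>
    one_div_pos.2 (Real.sqrt_pos.2 (hQ p hp))
  have hε2 : ∀ p > (1 : ℝ), (-u p (xm p)) ^ (p - 1) * (p * ε p ^ 2) = 1 := fun p hp => by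
    have h := (hQ p hp).ne'
    simp only [hε, div_pow, one_pow, Real.sq_sqrt (hQ p hp).le]
    rw [← mul_assoc, mul_comm _ p, mul_one_div, div_self h]
  have hεsmall : ∀ δ > (0 : ℝ), ∀ᶠ p in atTop, ε p < δ := fun δ hδ => by
    filter_upwards [hNL.eventually_gt_atTop (max 0 (Metric.diam Ω / δ)), eventually_gt_atTop 1]
      with p hp hp1
    have h0 : 0 < Metric.infDist (xm p) {x ∈ Ω | u p x = 0} := by
      have := (le_max_left _ _).trans_lt hp
      exact (div_pos_iff_of_pos_right (hεpos p hp1)).1 this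
    have hnon : {x ∈ Ω | u p x = 0}.Nonempty := by
      by_contra! h
      simp [h] at h0
    obtain ⟨w, hw⟩ := hnon
    have hle : Metric.infDist (xm p) {x ∈ Ω | u p x = 0} ≤ Metric.diam Ω :=
      (infDist_le_dist_of_mem hw).trans (dist_le_diam_of_mem hbdd (hxmmem p hp1) hw.1)
    have h1 := (le_max_right _ _).trans_lt hp
    rw [div_lt_div_iff₀ hδ (hεpos p hp1)] at h1
    by_contra! hge
    have := mul_le_mul hle hge hδ.le diam_nonneg
    linarith
  have hfr := frontier_nonempty_of_isBounded hne hbdd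
  rw [Filter.tendsto_atTop]
  by_contra! hcon
  obtain ⟨C, hC⟩ := hcon
  replace hC : ∃ᶠ p in atTop, 1 < p ∧ ∃ y ∈ frontier Ω, dist (xm p) y < C * ε p := by
    refine (hC.and_eventually (eventually_gt_atTop 1)).mono fun p hp => ⟨hp.2, ?_⟩
    rw [← infDist_lt_iff hfr, ← div_lt_iff₀ (hεpos p hp.2)]
    exact hp.1
  have hcl : ∃ y₀ ∈ frontier Ω, ∀ δ > 0, ∃ᶠ p in atTop,
      1 < p ∧ ∃ y ∈ frontier Ω, dist (xm p) y < C * ε p ∧ dist y y₀ < δ := by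
    by_contra! h
    have hcomp : IsCompact (frontier Ω) :=
      isCompact_of_isClosed_isBounded isClosed_frontier
        (hbdd.closure.subset frontier_subset_closure)
    choose! δ hδ hev using h
    obtain ⟨t, ht, hcover⟩ := hcomp.elim_nhds_subcover (fun y => ball y (δ y))
      fun y hy => ball_mem_nhds y (hδ y hy)
    have hall := (Filter.eventually_all_finset t).2 fun y hy => hev y (ht y hy)
    obtain ⟨p, ⟨hp, y, hy, hxy⟩, hno⟩ := (hC.and_eventually hall).exists
    obtain ⟨y', hy', hyy'⟩ := mem_iUnion₂.1 (hcover hy)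
    exact (hno y' hy' hp y hy hxy).not_gt hyy'
  obtain ⟨y₀, hy₀, hclust⟩ := hcl
  obtain ⟨r, hr, M, hM, hside⟩ := hsm.exists_side hop hy₀
  have hCpos : 0 < C := by
    obtain ⟨p, hp, y, -, hy⟩ := hC.exists
    exact pos_of_mul_pos_left (dist_nonneg.trans_lt hy) (hεpos p hp).le
  set Λ : ℝ := C + (1 + M) with hΛ
  have hΛpos : 0 < Λ := by positivity
  obtain ⟨p, ⟨hp, y, hy, hxy, hyy₀⟩, hεp, hpΛ⟩ := ((hclust (r / 2) (by positivity)).and_eventually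
    ((hεsmall (r / (4 * Λ)) (by positivity)).and (eventually_gt_atTop (Λ ^ 4 / 4)))).exists
  have hεp' : Λ * ε p < r / 4 := by
    rw [lt_div_iff₀ (by positivity)] at hεp
    linarith
  have hpos := hεpos p hp
  have hΛe : Λ * ε p = C * ε p + (1 + M) * ε p := by rw [hΛ]; ring
  have hMe : 0 ≤ (1 + M) * ε p := by positivity
  have hCe : 0 < C * ε p := by positivity
  have hxr : xm p ∈ ball y₀ r := by
    rw [Metric.mem_ball]
    linarith [dist_triangle (xm p) y y₀]
  obtain ⟨z, hyz, S, hSo, hxS, hSa, hScl⟩ :=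
    hside y hy (xm p) (hxmmem p hp) (by rw [Metric.mem_ball]; linarith) hxr (ε p) hpos
  have hball : closedBall z (Λ * ε p) ⊆ ball y₀ r := fun w hw => by
    rw [Metric.mem_closedBall] at hw
    rw [Metric.mem_ball]
    have h1 := dist_triangle w z y₀
    have h2 := dist_triangle z y y₀
    rw [dist_comm z y] at h2
    linarith
  obtain ⟨hu2, hu1, heq, hu0⟩ := hsol p hp
  have hum : ∀ w ∈ Ω, -(-u p (xm p)) ≤ u p w := fun w hw => by
    rw [neg_neg]
    exact hxmmin p hp w hw
  refine ne_neg_of_barrier (x := xm p) (z := z) (a := ε p) (L := Λ * ε p) hop hSo hu2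
    hu1.continuousOn hu0 (hm p hp) hpos hum ?_ (hxmmem p hp) hxS ?_
    (fun w hw hwL => hSa w hw (hball hwL)) (fun w hw hwΩ hwL => hScl w hw hwΩ (hball hwL))
    (neg_neg _).symm
  · intro w hw
    have h1 : lap (u p) w ≤ (-u p (xm p)) ^ (p - 1) * (-u p (xm p)) := by
      have h := neg_abs_rpow_mul_le hp (hm p hp) (hum w hw)
      rwa [← heq w hw, neg_neg] at h
    refine h1.trans_lt ?_
    rw [lt_div_iff₀ (by positivity)]
    set m := -u p (xm p) with hmdef
    have hmp := hm p hp
    have hA0 : 0 < m ^ (p - 1) := Real.rpow_pos_of_pos hmp _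
    have h3 : Λ ^ 4 * (m * ε p ^ 2) < 4 * p * (m * ε p ^ 2) := by
      gcongr
      linarith
    calc m ^ (p - 1) * m * (Λ * ε p) ^ 4
        = m ^ (p - 1) * ε p ^ 2 * (Λ ^ 4 * (m * ε p ^ 2)) := by ring
      _ < m ^ (p - 1) * ε p ^ 2 * (4 * p * (m * ε p ^ 2)) := by gcongr
      _ = m ^ (p - 1) * (p * ε p ^ 2) * (4 * (m * ε p ^ 2)) := by ring
      _ = 4 * (m * ε p ^ 2) := by rw [hε2 p hp, one_mul]
  · linarith [dist_triangle (xm p) y z]
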